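/- arXiv:1709.02424 — 2 statements merged into one kernel-verified Lean document; each statement's English description precedes it below -/
import Mathlib

section
/- Let 1 ≤ p < ∞ and n ≥ 2. There is a function φ_p^n with φ_p^n(Δ) → 0 as Δ → 0 such that for all 0 ≤ Δ ≤ 1, the cap C_p^n(Δ) = {x ∈ B_p^n : x₁ ≥ 1 − Δ} satisfies |C_p^n(Δ)|ₙ = (1/(n−1+p))·|B_p^{n−1}|_{n−1}·(pΔ)^{(n−1+p)/p}·(1 − φ_p^n(Δ)); in particular lim_{Δ→0} |C_p^n(Δ)|ₙ / Δ^{(n−1+p)/p} = p^{(n−1+p)/p}·|B_p^{n−1}|_{n−1}/(n−1+p). -/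
open MeasureTheory Metric Set Filter
open scoped RealInnerProductSpace Pointwise Topology

noncomputable section

abbrev Euc (n : ℕ) : Type := EuclideanSpace ℝ (Fin n)

/-- A centrally symmetric convex body in `ℝⁿ`. -/
def IsSymConvexBody {n : ℕ} (S : Set (Euc n)) : Prop :=
  IsCompact S ∧ Convex ℝ S ∧ (interior S).Nonempty ∧ S = -S

/-- The convex floating body `K_δ`: the intersection of all closed halfspaces whose bounding
hyperplane cuts off a set of volume at most `δ·|K|ₙ` from `K`. -/
def floatingBody {n : ℕ} (K : Set (Euc n)) (δ : ℝ) : Set (Euc n) :=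
  ⋂ (v : Euc n) (_ : v ≠ 0) (c : ℝ)
    (_ : volume (K ∩ {y | c ≤ ⟪v, y⟫}) ≤ ENNReal.ofReal δ * volume K),
    {y | ⟪v, y⟫ ≤ c}

/-- The illumination body `K^δ`. -/
def illuminationBody {n : ℕ} (K : Set (Euc n)) (δ : ℝ) : Set (Euc n) :=
  {x | volume (convexHull ℝ (K ∪ {x})) ≤ ENNReal.ofReal (1 + δ) * volume K}

/-- The polar body `K°`. -/
def polarBody {n : ℕ} (K : Set (Euc n)) : Set (Euc n) :=
  {y | ∀ x ∈ K, ⟪x, y⟫ ≤ 1}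

/-- The distance `d(C₁, C₂) = inf {a ≥ 1 : a⁻¹ C₁ ⊆ C₂ ⊆ a C₁}`. -/
def bodyDist {n : ℕ} (C₁ C₂ : Set (Euc n)) : ℝ :=
  sInf {a : ℝ | 1 ≤ a ∧ a⁻¹ • C₁ ⊆ C₂ ∧ C₂ ⊆ a • C₁}

/-- `d_C(δ) = inf_{δ' > 0} d(C_δ, ((C°)^{δ'})°)`. -/
def dualDist {n : ℕ} (C : Set (Euc n)) (δ : ℝ) : ℝ :=
  sInf {r : ℝ | ∃ δ' > (0:ℝ), r = bodyDist (floatingBody C δ)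
      (polarBody (illuminationBody (polarBody C) δ'))}

/-- `ν` is an outer unit normal of `S` at `x`. -/
def IsOuterNormalAt {n : ℕ} (S : Set (Euc n)) (x ν : Euc n) : Prop :=
  ‖ν‖ = 1 ∧ ∀ y ∈ S, ⟪y, ν⟫ ≤ ⟪x, ν⟫

/-- Near `x ∈ ∂S`, the boundary of `S` is the graph of a `C²` function `f` over the tangent
hyperplane at `x` (embedded via a linear isometry `L` orthogonal to the normal `ν`), with
`f 0 = 0` and vanishing derivative at `0`, and `k` is the determinant of the Hessian of `f`
at `0`, i.e. the Gauss curvature of `∂S` at `x`. -/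
def IsGaussCurvatureAt {n : ℕ} (S : Set (Euc n)) (x ν : Euc n) (k : ℝ) : Prop :=
  ∃ (L : Euc (n-1) →ₗᵢ[ℝ] Euc n) (f : Euc (n-1) → ℝ) (τ ε : ℝ),
    0 < τ ∧ 0 < ε ∧
    (∀ v, ⟪L v, ν⟫ = 0) ∧
    ContDiffOn ℝ 2 f (ball 0 τ) ∧
    f 0 = 0 ∧ fderiv ℝ f 0 = 0 ∧
    frontier S ∩ ball x ε
      = {y | ∃ v ∈ ball (0 : Euc (n-1)) τ, y = x + L v - f v • ν} ∩ ball x ε ∧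
    k = (Matrix.of fun i j : Fin (n-1) =>
      iteratedFDeriv ℝ 2 f 0 ![EuclideanSpace.single i 1, EuclideanSpace.single j 1]).det

/-- `S` has `C²` boundary, with outer unit normal map `u` and Gauss curvature function `κ`. -/
def IsC2Body {n : ℕ} (S : Set (Euc n)) (u : Euc n → Euc n) (κ : Euc n → ℝ) : Prop :=
  ∀ x ∈ frontier S, IsOuterNormalAt S x (u x) ∧ IsGaussCurvatureAt S x (u x) (κ x)

/-- The constant `c(K, n) = ((n+1)^{2/(n+1)}/2)·(|K|ₙ/|B₂^{n−1}|_{n−1})^{2/(n+1)}`. -/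
def cConst (n : ℕ) (K : Set (Euc n)) : ℝ :=
  ((n + 1 : ℝ) ^ ((2:ℝ)/(n+1)) / 2) *
    ((volume K).toReal / (volume (ball (0 : Euc (n-1)) 1)).toReal) ^ ((2:ℝ)/(n+1))

/-- The function `G_S(x) = c(S,n)·κ(x)^{1/(n+1)} / ⟨x, u(x)⟩`. -/
def Gfun {n : ℕ} (S : Set (Euc n)) (u : Euc n → Euc n) (κ : Euc n → ℝ) (x : Euc n) : ℝ :=
  cConst n S * (κ x) ^ ((1:ℝ)/(n+1)) / ⟪x, u x⟫

/-- The unit ball of `ℓ_p^n`. -/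
def lpBall (n : ℕ) (p : ℝ) : Set (Euc n) :=
  {x | (∑ i, |x i| ^ p) ≤ 1}

theorem volume_lpBall_eq (m : ℕ) (p : ℝ) :
    volume (lpBall m p) = volume {y : Fin m → ℝ | ∑ i, |y i| ^ p ≤ 1} :=
  (EuclideanSpace.volume_preserving_symm_measurableEquiv_toLp (Fin m)).measure_preimage_equiv
    {y : Fin m → ℝ | ∑ i, |y i| ^ p ≤ 1}

theorem setOf_sum_rpow_le_eq {m : ℕ} {p : ℝ} (hp : 1 ≤ p) {s : ℝ} (hs : 0 ≤ s) :
    {y : Fin m → ℝ | ∑ i, |y i| ^ p ≤ s}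
      = {y : Fin m → ℝ | (∑ i, |y i| ^ p) ^ (1 / p) ≤ s ^ (1 / p)} := by
  ext y
  have hy : 0 ≤ ∑ i, |y i| ^ p := by positivity
  exact (Real.rpow_le_rpow_iff hy hs (by positivity)).symm

theorem toReal_volume_lpBall_pos {m : ℕ} (hm : 1 ≤ m) {p : ℝ} (hp : 1 ≤ p) :
    0 < (volume (lpBall m p)).toReal := by
  have : Nonempty (Fin m) := ⟨⟨0, hm⟩⟩
  have h1 : 0 < Real.Gamma (1 / p + 1) := Real.Gamma_pos_of_pos (by positivity)
  have h2 : 0 < Real.Gamma ((m : ℝ) / p + 1) := Real.Gamma_pos_of_pos (by positivity)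
  rw [volume_lpBall_eq, setOf_sum_rpow_le_eq hp zero_le_one, volume_sum_rpow_le _ hp]
  simp only [Real.one_rpow, ENNReal.ofReal_one, one_pow, one_mul, Fintype.card_fin]
  rw [ENNReal.toReal_ofReal (by positivity)]
  positivity

/-- The volume of the set `∑ |yᵢ|ᵖ ≤ s`, for every real `s`. -/
theorem volume_setOf_sum_rpow_le {m : ℕ} (hm : 1 ≤ m) {p : ℝ} (hp : 1 ≤ p) (s : ℝ) :
    volume {y : Fin m → ℝ | ∑ i, |y i| ^ p ≤ s}
      = ENNReal.ofReal ((volume (lpBall m p)).toReal * max 0 s ^ ((m : ℝ) / p)) := by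
  have : Nonempty (Fin m) := ⟨⟨0, hm⟩⟩
  have hmp : (0 : ℝ) < m / p := by positivity
  rcases lt_or_ge s 0 with hs | hs
  · have : {y : Fin m → ℝ | ∑ i, |y i| ^ p ≤ s} = ∅ := by
      ext y
      have hy : 0 ≤ ∑ i, |y i| ^ p := by positivity
      simpa using hs.trans_le hy
    rw [this, max_eq_left hs.le, Real.zero_rpow hmp.ne']
    simp
  · rw [max_eq_right hs, volume_lpBall_eq, setOf_sum_rpow_le_eq hp zero_le_one,
      setOf_sum_rpow_le_eq hp hs, volume_sum_rpow_le _ hp, volume_sum_rpow_le _ hp]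
    simp only [Real.one_rpow, ENNReal.ofReal_one, one_pow, one_mul, Fintype.card_fin]
    rw [mul_comm, ENNReal.ofReal_mul ENNReal.toReal_nonneg,
      ENNReal.ofReal_toReal ENNReal.ofReal_ne_top, ← ENNReal.ofReal_pow (by positivity),
      ← Real.rpow_mul_natCast hs, one_div_mul_eq_div]

theorem continuous_max_one_sub_abs_rpow {p q : ℝ} (hp : 0 ≤ p) (hq : 0 ≤ q) :
    Continuous fun t : ℝ => max 0 (1 - |t| ^ p) ^ q :=
  (continuous_const.max (continuous_const.sub
    (continuous_abs.rpow_const fun _ => Or.inr hp))).rpow_const fun _ => Or.inr hq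

/-- Slicing the cap of `lpBall (m + 1) p` orthogonally to the first coordinate. -/
theorem toReal_volume_cap {m : ℕ} (hm : 1 ≤ m) {p : ℝ} (hp : 1 ≤ p) {Δ : ℝ} (hΔ : 0 ≤ Δ) :
    (volume {x ∈ lpBall (m + 1) p | 1 - Δ ≤ x 0}).toReal
      = (volume (lpBall m p)).toReal
        * ∫ t in (1 - Δ)..1, max 0 (1 - |t| ^ p) ^ ((m : ℝ) / p) := by
  have hp0 : 0 < p := by linarith
  set A := (volume (lpBall m p)).toReal
  set f : ℝ → ℝ := fun t => max 0 (1 - |t| ^ p) ^ ((m : ℝ) / p)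
  have hfc : Continuous f := continuous_max_one_sub_abs_rpow hp0.le (by positivity)
  have hf0 (t : ℝ) : 0 ≤ f t := by positivity
  let T : Set (ℝ × (Fin m → ℝ)) := {z | |z.1| ^ p + ∑ i, |z.2 i| ^ p ≤ 1 ∧ 1 - Δ ≤ z.1}
  have hT : MeasurableSet T := by
    have h : Measurable fun z : ℝ × (Fin m → ℝ) => |z.1| ^ p + ∑ i, |z.2 i| ^ p := by fun_prop
    exact (measurableSet_le h measurable_const).inter
      (measurableSet_le measurable_const measurable_fst)
  have key : volume {x ∈ lpBall (m + 1) p | 1 - Δ ≤ x 0} = volume T := by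
    rw [← (volume_preserving_piFinSuccAbove (fun _ : Fin (m + 1) => ℝ) 0).measure_preimage_equiv T,
      ← (EuclideanSpace.volume_preserving_symm_measurableEquiv_toLp
        (Fin (m + 1))).measure_preimage_equiv]
    congr 1
    ext x
    simp only [lpBall, Fin.sum_univ_succ]
    rfl
  have slice (t : ℝ) : volume (Prod.mk t ⁻¹' T)
      = (Icc (1 - Δ) 1).indicator (fun t => ENNReal.ofReal (A * f t)) t := by
    have hset : 1 - Δ ≤ t → Prod.mk t ⁻¹' T = {y | ∑ i, |y i| ^ p ≤ 1 - |t| ^ p} := by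
      intro ht
      ext y
      simp only [T, mem_preimage, mem_ofPred_eq, ht, and_true]
      constructor <;> intro h <;> linarith
    rcases lt_or_ge t (1 - Δ) with h1 | h1
    · rw [indicator_of_notMem (fun h => absurd h.1 (not_le.2 h1))]
      have : Prod.mk t ⁻¹' T = ∅ := by
        ext y
        simpa [T] using fun _ => lt_sub_iff_add_lt.1 h1
      simp [this]
    · rw [hset h1, volume_setOf_sum_rpow_le hm hp]
      rcases le_or_gt t 1 with h2 | h2
      · rw [indicator_of_mem (mem_Icc.2 ⟨h1, h2⟩)]
      · rw [indicator_of_notMem (fun h => absurd h.2 (not_le.2 h2))]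
        have : 1 ≤ |t| ^ p := Real.one_le_rpow (h2.le.trans (le_abs_self t)) hp0.le
        rw [max_eq_left (by linarith), Real.zero_rpow (by positivity)]
        simp
  rw [key, Measure.volume_eq_prod, Measure.prod_apply hT, lintegral_congr slice,
    lintegral_indicator measurableSet_Icc, ← intervalIntegral.integral_const_mul,
    intervalIntegral.integral_of_le (by linarith), ← integral_Icc_eq_integral_Ioc,
    integral_eq_lintegral_of_nonneg_ae
      (Eventually.of_forall fun t => mul_nonneg ENNReal.toReal_nonneg (hf0 t))
      (continuous_const.mul hfc).aestronglyMeasurable]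

theorem tendsto_one_sub_abs_rpow_div {p : ℝ} :
    Tendsto (fun x : ℝ => (1 - |1 - x| ^ p) / x) (𝓝[>] 0) (𝓝 p) := by
  have h : HasDerivAt (fun x : ℝ => 1 - (1 - x) ^ p) p 0 := by
    have h1 : HasDerivAt (fun x : ℝ => 1 - x) (-1) 0 := by
      simpa using (hasDerivAt_id (0 : ℝ)).const_sub 1
    simpa using (h1.rpow_const (p := p) (Or.inl (by norm_num))).const_sub 1
  have h' := (hasDerivAt_iff_tendsto_slope_zero.1 h).mono_left
    (nhdsWithin_mono _ fun x (hx : 0 < x) => hx.ne')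
  refine h'.congr' ?_
  filter_upwards [Ioo_mem_nhdsGT (zero_lt_one' ℝ)] with x hx
  rw [abs_of_pos (by linarith [hx.2])]
  simp [div_eq_inv_mul]

theorem tendsto_integral_div_rpow {p q : ℝ} (hp : 0 < p) (hq : 0 < q) :
    Tendsto (fun x : ℝ => (∫ t in (1 - x)..1, max 0 (1 - |t| ^ p) ^ q) / x ^ (q + 1))
      (𝓝[>] 0) (𝓝 (p ^ q / (q + 1))) := by
  have hc : Continuous fun t : ℝ => max 0 (1 - |t| ^ p) ^ q :=
    continuous_max_one_sub_abs_rpow hp.le hq.le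
  have hderiv (x : ℝ) : HasDerivAt (fun x : ℝ => ∫ t in (1 - x)..1, max 0 (1 - |t| ^ p) ^ q)
      (max 0 (1 - |1 - x| ^ p) ^ q) x := by
    have h1 : HasDerivAt (fun x : ℝ => 1 - x) (-1) x := by
      simpa using (hasDerivAt_id x).const_sub 1
    have h2 := intervalIntegral.integral_hasDerivAt_left (hc.intervalIntegrable (1 - x) 1)
      (hc.stronglyMeasurableAtFilter _ _) hc.continuousAt
    simpa using! h2.comp x h1
  refine HasDerivAt.lhopital_zero_nhdsGT (Eventually.of_forall hderiv)
    (g' := fun x => (q + 1) * x ^ q) ?_ ?_ ?_ ?_ ?_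
  · filter_upwards [self_mem_nhdsWithin] with x (hx : 0 < x)
    simpa using Real.hasDerivAt_rpow_const (p := q + 1) (Or.inl hx.ne')
  · filter_upwards [self_mem_nhdsWithin] with x (hx : 0 < x)
    positivity
  · have := (hderiv 0).continuousAt.tendsto
    simp only [sub_zero, intervalIntegral.integral_same] at this
    exact this.mono_left nhdsWithin_le_nhds
  · have := (Real.continuousAt_rpow_const 0 (q + 1) (Or.inr (by positivity))).tendsto
    rw [Real.zero_rpow (by positivity)] at this
    exact this.mono_left nhdsWithin_le_nhds
  · have h := ((tendsto_one_sub_abs_rpow_div (p := p)).rpow_const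
      (p := q) (Or.inl hp.ne')).div_const (q + 1)
    refine h.congr' ?_
    filter_upwards [Ioo_mem_nhdsGT (zero_lt_one' ℝ)] with x hx
    have h1 : |1 - x| ^ p ≤ 1 :=
      Real.rpow_le_one (abs_nonneg _) (abs_le.2 ⟨by linarith [hx.2], by linarith [hx.1]⟩) hp.le
    rw [max_eq_right (by linarith), Real.div_rpow (by linarith) hx.1.le, div_div, mul_comm]

/-- Lemma 4.5: the volume of the cap `C_p^n(Δ) = {x ∈ B_p^n : x₁ ≥ 1 − Δ}` equals
`(1/(n−1+p))·|B_p^{n−1}|·(pΔ)^{(n−1+p)/p}·(1 − φ_p^n(Δ))` with `φ_p^n(Δ) → 0`. -/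
theorem statement17 {n : ℕ} (hn : 2 ≤ n) (p : ℝ) (hp : 1 ≤ p) :
    ∃ φ : ℝ → ℝ, Tendsto φ (𝓝[>] 0) (𝓝 0) ∧
      (∀ Δ : ℝ, 0 ≤ Δ → Δ ≤ 1 →
        (volume {x ∈ lpBall n p | 1 - Δ ≤ x ⟨0, by omega⟩}).toReal
          = 1/((n:ℝ) - 1 + p) * (volume (lpBall (n-1) p)).toReal *
            (p*Δ) ^ (((n:ℝ) - 1 + p)/p) * (1 - φ Δ)) ∧
      Tendsto (fun Δ : ℝ =>
          (volume {x ∈ lpBall n p | 1 - Δ ≤ x ⟨0, by omega⟩}).toReal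
            / Δ ^ (((n:ℝ) - 1 + p)/p)) (𝓝[>] 0)
        (𝓝 (p ^ (((n:ℝ) - 1 + p)/p) * (volume (lpBall (n-1) p)).toReal / ((n:ℝ) - 1 + p))) := by
  obtain ⟨m, rfl⟩ : ∃ m, n = m + 1 := ⟨n - 1, by omega⟩
  have hm : 1 ≤ m := by omega
  have hp0 : 0 < p := by linarith
  have hcast : ((m + 1 : ℕ) : ℝ) - 1 = m := by push_cast; ring
  have he : ((m : ℝ) + p) / p = m / p + 1 := by field_simp
  have hA := toReal_volume_lpBall_pos hm hp
  have hV {Δ : ℝ} (hΔ : 0 ≤ Δ) := toReal_volume_cap hm hp hΔ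
  rw [hcast, he]
  change ∃ φ : ℝ → ℝ, _ ∧ (∀ Δ : ℝ, _ → _ →
    (volume {x ∈ lpBall (m + 1) p | 1 - Δ ≤ x 0}).toReal
      = 1 / ((m : ℝ) + p) * (volume (lpBall m p)).toReal * _ * _) ∧
    Tendsto (fun Δ : ℝ => (volume {x ∈ lpBall (m + 1) p | 1 - Δ ≤ x 0}).toReal / _) _
      (𝓝 (_ * (volume (lpBall m p)).toReal / _))
  set A := (volume (lpBall m p)).toReal
  set V : ℝ → ℝ := fun Δ => (volume {x ∈ lpBall (m + 1) p | 1 - Δ ≤ x 0}).toReal with hVdef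
  have hlim : Tendsto (fun Δ => V Δ / Δ ^ ((m : ℝ) / p + 1)) (𝓝[>] 0)
      (𝓝 (p ^ ((m : ℝ) / p + 1) * A / (m + p))) := by
    have h := (tendsto_integral_div_rpow hp0 (q := m / p) (by positivity)).const_mul A
    have hval : A * (p ^ ((m : ℝ) / p) / (m / p + 1)) = p ^ ((m : ℝ) / p + 1) * A / (m + p) := by
      rw [Real.rpow_add hp0, Real.rpow_one]
      field_simp
    rw [hval] at h
    refine h.congr' ?_
    filter_upwards [self_mem_nhdsWithin] with Δ (hΔ : 0 < Δ)
    rw [hVdef]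
    simp only [hV hΔ.le, mul_div_assoc]
  set L := p ^ ((m : ℝ) / p + 1) * A / (m + p) with hL
  have hLpos : 0 < L := by positivity
  refine ⟨fun Δ => 1 - V Δ / Δ ^ ((m : ℝ) / p + 1) / L, ?_, fun Δ h0 _ => ?_, hlim⟩
  · simpa [hLpos.ne'] using (hlim.div_const L).const_sub 1
  · rcases h0.eq_or_lt with rfl | hpos
    · rw [hV le_rfl, mul_zero, Real.zero_rpow (by positivity)]
      simp
    · have hΔ : 0 < Δ ^ ((m : ℝ) / p + 1) := by positivity
      have hc : 1 / ((m : ℝ) + p) * A * (p * Δ) ^ ((m : ℝ) / p + 1)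
          = L * Δ ^ ((m : ℝ) / p + 1) := by
        rw [Real.mul_rpow hp0.le hpos.le, hL]
        ring
      rw [hc]
      change V Δ = _
      field_simp
      ring
end
end

section
/- Let 1 < p < ∞ and n ≥ 2. There is a function ψ_p^n with ψ_p^n(Δ) → 0 as Δ → 0 such that for all 0 ≤ Δ ≤ 1, the hat H_p^n(Δ) = conv(B_p^n ∪ {(1+Δ)e₁}) \ B_p^n satisfies |H_p^n(Δ)|ₙ = ((p−1)/(n(n−1+p)))·|B_p^{n−1}|_{n−1}·((p/(p−1))·Δ)^{(n−1+p)/p}·(1 + ψ_p^n(Δ)); in particular lim_{Δ→0} |H_p^n(Δ)|ₙ / Δ^{(n−1+p)/p} = ((p−1)/(n(n−1+p)))·(p/(p−1))^{(n−1+p)/p}·|B_p^{n−1}|_{n−1}. -/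
open MeasureTheory Metric Set Filter
open scoped RealInnerProductSpace Pointwise Topology

noncomputable section

/-- The volume of the unit ball of `ℓ_p^m`. -/
def lpBallVol (m : ℕ) (p : ℝ) : ℝ :=
  (2 * Real.Gamma (1 / p + 1)) ^ m / Real.Gamma (m / p + 1)

lemma lpBallVol_pos (m : ℕ) {p : ℝ} (hp : 0 < p) : 0 < lpBallVol m p := by
  have h₁ : 0 < Real.Gamma (1 / p + 1) := Real.Gamma_pos_of_pos (by positivity)
  have h₂ : 0 < Real.Gamma (m / p + 1) := Real.Gamma_pos_of_pos (by positivity)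
  unfold lpBallVol
  positivity

lemma volume_sum_abs_rpow_le {m : ℕ} (hm : 1 ≤ m) {p : ℝ} (hp : 1 < p) {s : ℝ} (hs : 0 ≤ s) :
    volume {y : Fin m → ℝ | ∑ i, |y i| ^ p ≤ s ^ p} = ENNReal.ofReal (lpBallVol m p * s ^ m) := by
  have : Nonempty (Fin m) := ⟨⟨0, hm⟩⟩
  have hset : {y : Fin m → ℝ | ∑ i, |y i| ^ p ≤ s ^ p}
      = {y | (∑ i, |y i| ^ p) ^ (1 / p) ≤ s} := by
    ext y
    have h0 : 0 ≤ ∑ i, |y i| ^ p := by positivity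
    rw [mem_ofPred_eq, mem_ofPred_eq, one_div, Real.rpow_inv_le_iff_of_pos h0 hs (by linarith)]
  rw [hset, MeasureTheory.volume_sum_rpow_le _ hp.le, Fintype.card_fin, ← ENNReal.ofReal_pow hs,
    ← ENNReal.ofReal_mul (by positivity), mul_comm, lpBallVol]

lemma volume_lpBall {m : ℕ} (hm : 1 ≤ m) {p : ℝ} (hp : 1 < p) :
    (volume (lpBall m p)).toReal = lpBallVol m p := by
  have h := volume_sum_abs_rpow_le hm hp zero_le_one
  rw [← (PiLp.volume_preserving_ofLp (Fin m)).measure_preimage_equiv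
    (f := (MeasurableEquiv.toLp 2 (Fin m → ℝ)).symm)] at h
  simp only [Real.one_rpow, one_pow, mul_one] at h
  have h' : volume (lpBall m p) = ENNReal.ofReal (lpBallVol m p) := h
  rw [h', ENNReal.toReal_ofReal (lpBallVol_pos m (by linarith)).le]

/-- The solid with sections `ρ t • B_p^m` at height `t ∈ [α, β]`. -/
def solid (m : ℕ) (p α β : ℝ) (ρ : ℝ → ℝ) : Set (Euc (m + 1)) :=
  {x | x 0 ∈ Icc α β ∧ ∑ i : Fin m, |x i.succ| ^ p ≤ ρ (x 0) ^ p}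

lemma measurableSet_solid (m : ℕ) {p : ℝ} (α β : ℝ) {ρ : ℝ → ℝ} (hρ : Continuous ρ) :
    MeasurableSet (solid m p α β ρ) := by
  have h0 : Measurable fun x : Euc (m + 1) => x 0 := by fun_prop
  refine (h0 measurableSet_Icc).inter
    (s₂ := {x | ∑ i : Fin m, |x i.succ| ^ p ≤ ρ (x 0) ^ p}) (measurableSet_le ?_ ?_)
  · fun_prop
  · exact (hρ.measurable.comp h0).pow_const p

lemma volume_solid {m : ℕ} (hm : 1 ≤ m) {p : ℝ} (hp : 1 < p) {α β : ℝ} (hαβ : α ≤ β)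
    {ρ : ℝ → ℝ} (hρ : Continuous ρ) (hρ0 : ∀ t ∈ Icc α β, 0 ≤ ρ t) :
    volume (solid m p α β ρ) = ENNReal.ofReal (lpBallVol m p * ∫ t in α..β, ρ t ^ m) := by
  let S : Set (ℝ × (Fin m → ℝ)) := {q | q.1 ∈ Icc α β ∧ ∑ i, |q.2 i| ^ p ≤ ρ q.1 ^ p}
  have hS : MeasurableSet S := by
    refine (measurable_fst measurableSet_Icc).inter
      (s₂ := {q : ℝ × (Fin m → ℝ) | ∑ i, |q.2 i| ^ p ≤ ρ q.1 ^ p}) (measurableSet_le ?_ ?_)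
    · fun_prop
    · exact (hρ.measurable.comp measurable_fst).pow_const p
  have hvol : volume (solid m p α β ρ) = volume S := by
    have h := ((volume_preserving_piFinSuccAbove (fun _ : Fin (m + 1) => ℝ) 0).comp
      (PiLp.volume_preserving_ofLp (Fin (m + 1)))).measure_preimage hS.nullMeasurableSet
    rw [← h]
    rfl
  have hslice : ∀ t, volume (Prod.mk t ⁻¹' S)
      = (Icc α β).indicator (fun t => ENNReal.ofReal (lpBallVol m p * ρ t ^ m)) t := by
    intro t
    by_cases ht : t ∈ Icc α β
    · rw [indicator_of_mem ht, ← volume_sum_abs_rpow_le hm hp (hρ0 t ht)]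
      congr 1
      ext y
      exact and_iff_right ht
    · rw [indicator_of_notMem ht]
      convert measure_empty (μ := volume)
      ext y
      simpa using fun h : (t, y) ∈ S => ht h.1
  have hint : IntegrableOn (fun t => lpBallVol m p * ρ t ^ m) (Icc α β) :=
    (continuous_const.mul (hρ.pow m)).integrableOn_Icc
  rw [hvol, Measure.volume_eq_prod, Measure.prod_apply hS, lintegral_congr hslice,
    lintegral_indicator measurableSet_Icc, ← ofReal_integral_eq_lintegral_ofReal hint,
    integral_Icc_eq_integral_Ioc, ← intervalIntegral.integral_of_le hαβ,
    intervalIntegral.integral_const_mul]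
  filter_upwards [ae_restrict_mem measurableSet_Icc] with t ht
  exact mul_nonneg (lpBallVol_pos m (by linarith)).le (pow_nonneg (hρ0 t ht) m)
lemma convex_lpBall (n : ℕ) {p : ℝ} (hp : 1 ≤ p) : Convex ℝ (lpBall n p) := by
  have hc : ∀ i : Fin n, ConvexOn ℝ univ fun x : Euc n => |x i| ^ p := by
    intro i
    refine ⟨convex_univ, fun x _ y _ a b ha hb hab => ?_⟩
    calc |(a • x + b • y) i| ^ p ≤ (a • |x i| + b • |y i|) ^ p := by
          refine Real.rpow_le_rpow (abs_nonneg _) ?_ (by linarith)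
          simpa [abs_mul, abs_of_nonneg ha, abs_of_nonneg hb] using abs_add_le (a * x i) (b * y i)
      _ ≤ _ := (convexOn_rpow hp).2 (mem_Ici.2 (abs_nonneg _)) (mem_Ici.2 (abs_nonneg _)) ha hb hab
  intro x hx y hy a b ha hb hab
  simp only [lpBall, mem_ofPred_eq] at *
  calc ∑ i, |(a • x + b • y) i| ^ p
      ≤ ∑ i, (a * |x i| ^ p + b * |y i| ^ p) :=
        Finset.sum_le_sum fun i _ => (hc i).2 trivial trivial ha hb hab
    _ = a * ∑ i, |x i| ^ p + b * ∑ i, |y i| ^ p := by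
        rw [Finset.sum_add_distrib, Finset.mul_sum, Finset.mul_sum]
    _ ≤ a * 1 + b * 1 := by gcongr
    _ = 1 := by linarith

lemma tangent_line_le {p : ℝ} (hp : 1 < p) {a b u r : ℝ} (ha : 0 ≤ a) (hb : 0 ≤ b)
    (hab : a ^ p + b ^ p = 1) (hur : |u| ^ p + |r| ^ p ≤ 1) :
    a ^ (p - 1) * u + b ^ (p - 1) * r ≤ 1 := by
  have hpq : (p / (p - 1)).HolderConjugate p := (Real.HolderConjugate.conjExponent hp).symm
  have key : ∀ c v : ℝ, 0 ≤ c → c ^ (p - 1) * v ≤ c ^ p * ((p - 1) / p) + |v| ^ p / p := by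
    intro c v hc
    have h := Real.young_inequality (c ^ (p - 1)) v hpq
    rw [abs_of_nonneg (by positivity), ← Real.rpow_mul hc,
      mul_div_cancel₀ _ (by linarith : p - 1 ≠ 0), div_div_eq_mul_div, mul_div_assoc] at h
    exact h
  have h₁ := key a u ha
  have h₂ := key b r hb
  have h₃ : (|u| ^ p + |r| ^ p) / p ≤ 1 / p := by gcongr
  have h₄ : (a ^ p + b ^ p) * ((p - 1) / p) + 1 / p = 1 := by
    rw [hab]; field_simp; ring
  rw [add_div] at h₃
  linarith

/-- The data of a tangent from the apex `h` on the axis to the `ℓ_p` unit circle at `(a, b)`. -/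
structure TangentData (p h a b : ℝ) : Prop where
  one_lt : 1 < p
  a_pos : 0 < a
  a_lt : a < 1
  lt_h : 1 < h
  b_pos : 0 < b
  circle : a ^ p + b ^ p = 1
  tangent : a ^ (p - 1) * h = 1

lemma TangentData.b_rpow {p h a b : ℝ} (H : TangentData p h a b) :
    b ^ p = a ^ (p - 1) * (h - a) := by
  have h₁ : a ^ p = a ^ (p - 1) * a := by
    rw [← Real.rpow_add_one H.a_pos.ne']; ring_nf
  have := H.circle
  have := H.tangent
  rw [mul_sub, ← h₁]; linarith

lemma TangentData.radius_le {p h a b : ℝ} (H : TangentData p h a b) {u r : ℝ}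
    (hur : |u| ^ p + |r| ^ p ≤ 1) : r ≤ b / (h - a) * (h - u) := by
  have h₁ := tangent_line_le H.one_lt H.a_pos.le H.b_pos.le H.circle hur
  have h₂ : b ^ p = b ^ (p - 1) * b := by
    rw [← Real.rpow_add_one H.b_pos.ne']; ring_nf
  have h₃ : 0 < h - a := by linarith [H.a_lt, H.lt_h]
  have ha : 0 < a ^ (p - 1) := Real.rpow_pos_of_pos H.a_pos _
  have h₄ := H.b_rpow
  rw [div_mul_eq_mul_div, le_div_iff₀ h₃, ← mul_le_mul_iff_right₀ ha]
  have h₅ : b ^ (p - 1) * r ≤ a ^ (p - 1) * (h - u) := by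
    rw [mul_sub, H.tangent]; linarith
  calc a ^ (p - 1) * (r * (h - a)) = b * (b ^ (p - 1) * r) := by
        linear_combination r * (h₂ - h₄)
    _ ≤ b * (a ^ (p - 1) * (h - u)) := by gcongr; exact H.b_pos.le
    _ = a ^ (p - 1) * (b * (h - u)) := by ring

lemma TangentData.sum_le_of_mem {p h a b : ℝ} (H : TangentData p h a b) {m : ℕ}
    {x : Euc (m + 1)} (hx : x ∈ lpBall (m + 1) p) :
    ∑ i : Fin m, |x i.succ| ^ p ≤ (b / (h - a) * (h - x 0)) ^ p := by
  have hp : 0 < p := by linarith [H.one_lt]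
  have h0 : 0 ≤ ∑ i : Fin m, |x i.succ| ^ p := by positivity
  have hr : ((∑ i : Fin m, |x i.succ| ^ p) ^ p⁻¹) ^ p = ∑ i : Fin m, |x i.succ| ^ p :=
    Real.rpow_inv_rpow h0 hp.ne'
  have hx' : ∑ i, |x i| ^ p ≤ 1 := hx
  rw [Fin.sum_univ_succ, ← hr] at hx'
  nth_rewrite 1 [← hr]
  refine Real.rpow_le_rpow (by positivity) (H.radius_le ?_) hp.le
  rwa [abs_of_nonneg (by positivity : 0 ≤ (∑ i : Fin m, |x i.succ| ^ p) ^ p⁻¹)]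

lemma apply_zero_le_of_mem_lpBall {m : ℕ} {p : ℝ} (hp : 0 < p) {x : Euc (m + 1)}
    (hx : x ∈ lpBall (m + 1) p) : x 0 ≤ 1 := by
  have h₁ : ∑ i, |x i| ^ p ≤ 1 := hx
  have h₂ : |x 0| ^ p ≤ 1 :=
    (Finset.single_le_sum (f := fun i => |x i| ^ p) (fun i _ => by positivity)
      (Finset.mem_univ 0)).trans h₁
  by_contra! h
  exact h₂.not_gt (Real.one_lt_rpow (h.trans_le (le_abs_self _)) hp)

lemma sum_abs_mul_rpow {m : ℕ} (p : ℝ) {c : ℝ} (hc : 0 ≤ c) (y : Fin m → ℝ) :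
    ∑ i, |c * y i| ^ p = c ^ p * ∑ i, |y i| ^ p := by
  rw [Finset.mul_sum]
  refine Finset.sum_congr rfl fun i _ => ?_
  rw [abs_mul, abs_of_nonneg hc, Real.mul_rpow hc (abs_nonneg _)]

lemma TangentData.convexHull_diff {p h a b : ℝ} (H : TangentData p h a b) (m : ℕ) :
    convexHull ℝ (lpBall (m + 1) p ∪ {EuclideanSpace.single 0 h}) \ lpBall (m + 1) p
      = solid m p a h (fun t => b / (h - a) * (h - t)) \ lpBall (m + 1) p := by
  have hp : 0 < p := by linarith [H.one_lt]
  have ha1 := H.a_lt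
  have hh1 := H.lt_h
  have hha : 0 < h - a := by linarith
  have hconv := convex_lpBall (m + 1) H.one_lt.le
  have hmem : ∀ x : Euc (m + 1), x ∈ lpBall (m + 1) p ↔
      |x 0| ^ p + ∑ i : Fin m, |x i.succ| ^ p ≤ 1 := fun x => by
    rw [lpBall, mem_ofPred_eq, Fin.sum_univ_succ]
  have hne : (lpBall (m + 1) p).Nonempty := ⟨0, by simp [lpBall, Real.zero_rpow hp.ne']⟩
  have hk : 0 < b / (h - a) := div_pos H.b_pos hha
  have hkb : b / (h - a) * (h - a) = b := div_mul_cancel₀ _ hha.ne'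
  ext x
  rw [union_singleton, convexHull_insert hne, hconv.convexHull_eq, Set.mem_sdiff, Set.mem_sdiff]
  refine and_congr_left fun hx => ?_
  simp only [mem_convexJoin, mem_singleton_iff, exists_eq_left]
  constructor
  · rintro ⟨u, hu, α, β, hα, hβ, hαβ, rfl⟩
    have hu1 := apply_zero_le_of_mem_lpBall hp hu
    have hcone : ∀ α β : ℝ, 0 ≤ β → α + β = 1 →
        ∑ i : Fin m, |(α • EuclideanSpace.single 0 h + β • u : Euc (m + 1)) i.succ| ^ p
          ≤ (b / (h - a) * (h - (α • EuclideanSpace.single 0 h + β • u : Euc (m + 1)) 0)) ^ p := by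
      intro α β hβ hαβ
      obtain rfl : α = 1 - β := by linarith
      have h₁ := H.sum_le_of_mem hu
      have h₂ : b / (h - a) * (h - ((1 - β) * h + β * u 0)) = β * (b / (h - a) * (h - u 0)) := by
        ring
      simp only [PiLp.add_apply, PiLp.smul_apply, smul_eq_mul, PiLp.single_apply,
        Fin.succ_ne_zero, if_false, mul_zero, zero_add, if_true]
      rw [sum_abs_mul_rpow p hβ (fun i : Fin m => u i.succ), h₂,
        Real.mul_rpow hβ (mul_nonneg hk.le (by linarith))]
      gcongr
    have hz : ∀ α β : ℝ, (α • EuclideanSpace.single 0 h + β • u : Euc (m + 1)) 0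
        = α * h + β * u 0 := by
      intro α β; simp
    refine ⟨⟨?_, ?_⟩, hcone α β hβ hαβ⟩
    · by_contra! hlt
      apply hx
      rw [hz] at hlt
      obtain rfl : β = 1 - α := by linarith
      have hua : u 0 < a := by nlinarith
      have hden : 0 < h - u 0 := by linarith
      have hα_le : (a - u 0) / (h - u 0) ≤ 1 := by rw [div_le_one hden]; linarith
      have hα_pos : 0 < (a - u 0) / (h - u 0) := div_pos (by linarith) hden
      have hle : α ≤ (a - u 0) / (h - u 0) := by
        rw [le_div_iff₀ hden]; nlinarith
      generalize hα' : (a - u 0) / (h - u 0) = α' at *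
      have hqa : α' * h + (1 - α') * u 0 = a := by
        rw [← hα']; field_simp; ring
      have hq : α' • EuclideanSpace.single 0 h + (1 - α') • u ∈ lpBall (m + 1) p := by
        have h₁ := hcone α' (1 - α') (by linarith) (by ring)
        rw [hmem]
        rw [hz, hqa] at h₁ ⊢
        rw [hkb] at h₁
        rw [abs_of_pos H.a_pos]
        linarith [H.circle]
      have h₁ := hconv hq hu (div_nonneg hα hα_pos.le)
        (sub_nonneg.2 ((div_le_one hα_pos).2 hle)) (by ring)
      convert h₁ using 1
      rw [smul_add, smul_smul, smul_smul, add_assoc, ← add_smul, div_mul_cancel₀ _ hα_pos.ne']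
      congr 2
      field_simp
      ring
    · rw [hz]
      obtain rfl : α = 1 - β := by linarith
      nlinarith
  · rintro ⟨⟨hxa, hxh⟩, hN⟩
    have hN' : ∑ i : Fin m, |x i.succ| ^ p ≤ (b / (h - a) * (h - x 0)) ^ p := hN
    set β := (h - x 0) / (h - a) with hβ
    have hβ0 : 0 ≤ β := div_nonneg (by linarith) hha.le
    have hβ1 : β ≤ 1 := by rw [hβ, div_le_one hha]; linarith
    have hx0 : x 0 = (1 - β) * h + β * a := by rw [hβ]; field_simp; ring
    have hrad : b / (h - a) * (h - x 0) = β * b := by rw [hβ]; ring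
    rw [hrad] at hN'
    rcases hβ0.eq_or_lt with h0 | hpos
    · rw [← h0, zero_mul, Real.zero_rpow hp.ne'] at hN'
      have hz : ∀ i : Fin m, x i.succ = 0 := by
        intro i
        have h₁ := (Finset.sum_eq_zero_iff_of_nonneg fun j _ => by positivity).1
          (le_antisymm hN' (by positivity)) i (Finset.mem_univ i)
        simpa [Real.rpow_eq_zero_iff_of_nonneg, hp.ne'] using h₁
      obtain ⟨u, hu⟩ := hne
      refine ⟨u, hu, ?_⟩
      convert left_mem_segment ℝ _ _ using 1
      ext i
      refine Fin.cases ?_ (fun j => ?_) i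
      · simp [hx0, ← h0]
      · simp [hz j]
    · refine ⟨β⁻¹ • (x - (1 - β) • EuclideanSpace.single 0 h), ?_, 1 - β, β, by linarith, hβ0,
        by ring, ?_⟩
      · have hq0 : (β⁻¹ • (x - (1 - β) • EuclideanSpace.single 0 h) : Euc (m + 1)) 0 = a := by
          simp only [PiLp.sub_apply, PiLp.smul_apply, smul_eq_mul, PiLp.single_apply,
            if_true]
          rw [hx0]; field_simp; ring
        have hqs : ∀ i : Fin m,
            (β⁻¹ • (x - (1 - β) • EuclideanSpace.single 0 h) : Euc (m + 1)) i.succ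
              = β⁻¹ * x i.succ := by
          intro i; simp
        rw [hmem, hq0]
        simp only [hqs]
        rw [sum_abs_mul_rpow p (inv_nonneg.2 hβ0) (fun i : Fin m => x i.succ),
          abs_of_pos H.a_pos, ← H.circle]
        gcongr
        calc β⁻¹ ^ p * ∑ i : Fin m, |x i.succ| ^ p ≤ β⁻¹ ^ p * (β * b) ^ p := by gcongr
          _ = b ^ p := by
            rw [← Real.mul_rpow (by positivity) (mul_nonneg hβ0 H.b_pos.le),
              inv_mul_cancel_left₀ hpos.ne']
      · rw [smul_smul, mul_inv_cancel₀ hpos.ne', one_smul, add_sub_cancel]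
/-- The profile of the `ℓ_p` unit ball over its first axis. -/
def profile (p t : ℝ) : ℝ := (1 - |t| ^ p) ^ p⁻¹

lemma continuous_profile {p : ℝ} (hp : 0 < p) : Continuous (profile p) :=
  (continuous_const.sub (continuous_abs.rpow_const fun _ => Or.inr hp.le)).rpow_const
    fun _ => Or.inr (inv_nonneg.2 hp.le)

lemma one_sub_abs_rpow_nonneg {p : ℝ} (hp : 0 < p) {a t : ℝ} (ha : 0 ≤ a) (ht : t ∈ Icc a 1) :
    0 ≤ 1 - |t| ^ p := by
  have h := Real.rpow_le_one (abs_nonneg t)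
    (by rw [abs_of_nonneg (ha.trans ht.1)]; exact ht.2) hp.le
  linarith

lemma mem_solid_profile_iff {m : ℕ} {p a : ℝ} (hp : 0 < p) (ha : 0 ≤ a) {x : Euc (m + 1)} :
    x ∈ solid m p a 1 (profile p) ↔ a ≤ x 0 ∧ x ∈ lpBall (m + 1) p := by
  have hx : x ∈ lpBall (m + 1) p ↔ ∑ i : Fin m, |x i.succ| ^ p ≤ 1 - |x 0| ^ p := by
    rw [lpBall, mem_ofPred_eq, Fin.sum_univ_succ, le_sub_iff_add_le']
  constructor
  · rintro ⟨h, hN⟩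
    rw [profile, Real.rpow_inv_rpow (one_sub_abs_rpow_nonneg hp ha h) hp.ne'] at hN
    exact ⟨h.1, hx.2 hN⟩
  · rintro ⟨h, hN⟩
    have h' : x 0 ∈ Icc a 1 := ⟨h, apply_zero_le_of_mem_lpBall hp hN⟩
    refine ⟨h', ?_⟩
    rw [profile, Real.rpow_inv_rpow (one_sub_abs_rpow_nonneg hp ha h') hp.ne']
    exact hx.1 hN

/-- The volume of the hat of `B_p^{m+1}` with apex at height `h`. -/
def hatVol (m : ℕ) (p h : ℝ) : ℝ :=
  (volume (convexHull ℝ (lpBall (m + 1) p ∪ {EuclideanSpace.single 0 h})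
    \ lpBall (m + 1) p)).toReal

lemma TangentData.hatVol_eq {p h a b : ℝ} (H : TangentData p h a b) {m : ℕ} (hm : 1 ≤ m) :
    hatVol m p h = lpBallVol m p *
      ((∫ t in a..h, (b / (h - a) * (h - t)) ^ m) - ∫ t in a..1, profile p t ^ m) := by
  have hp : 0 < p := by linarith [H.one_lt]
  have hha : 0 < h - a := by linarith [H.a_lt, H.lt_h]
  have hκ := (lpBallVol_pos m hp).le
  have hcap : ∀ x : Euc (m + 1), x ∈ solid m p a 1 (profile p) ↔ a ≤ x 0 ∧ x ∈ lpBall (m + 1) p :=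
    fun x => mem_solid_profile_iff hp H.a_pos.le
  have hsub : solid m p a 1 (profile p) ⊆ solid m p a h (fun t => b / (h - a) * (h - t)) := by
    intro x hx
    have hx' := (hcap x).1 hx
    exact ⟨⟨hx'.1, (apply_zero_le_of_mem_lpBall hp hx'.2).trans H.lt_h.le⟩, H.sum_le_of_mem hx'.2⟩
  have hdiff : solid m p a h (fun t => b / (h - a) * (h - t)) \ lpBall (m + 1) p
      = solid m p a h (fun t => b / (h - a) * (h - t)) \ solid m p a 1 (profile p) := by
    ext x
    rw [Set.mem_sdiff, Set.mem_sdiff, hcap]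
    exact and_congr_right fun hx => by rw [and_iff_right hx.1.1]
  have hprof0 : ∀ t ∈ Icc a 1, 0 ≤ profile p t := fun t ht =>
    Real.rpow_nonneg (one_sub_abs_rpow_nonneg hp H.a_pos.le ht) _
  have hcone0 : ∀ t ∈ Icc a h, 0 ≤ b / (h - a) * (h - t) := fun t ht =>
    mul_nonneg (div_nonneg H.b_pos.le hha.le) (sub_nonneg.2 ht.2)
  have hvcap := volume_solid hm H.one_lt H.a_lt.le (continuous_profile hp) hprof0
  have hvcone := volume_solid hm H.one_lt (H.a_lt.trans H.lt_h).le
    (ρ := fun t => b / (h - a) * (h - t)) (by fun_prop) hcone0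
  rw [hatVol, H.convexHull_diff, hdiff, measure_sdiff hsub
    (measurableSet_solid m a 1 (continuous_profile hp)).nullMeasurableSet
    (by rw [hvcap]; exact ENNReal.ofReal_ne_top),
    ENNReal.toReal_sub_of_le (measure_mono hsub) (by rw [hvcone]; exact ENNReal.ofReal_ne_top),
    hvcap, hvcone, ENNReal.toReal_ofReal, ENNReal.toReal_ofReal, mul_sub]
  · exact mul_nonneg hκ (intervalIntegral.integral_nonneg H.a_lt.le
      fun t ht => pow_nonneg (hprof0 t ht) m)
  · exact mul_nonneg hκ (intervalIntegral.integral_nonneg (H.a_lt.trans H.lt_h).le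
      fun t ht => pow_nonneg (hcone0 t ht) m)

lemma tangentData {p h : ℝ} (hp : 1 < p) (hh : 1 < h) :
    TangentData p h (h ^ (-(p - 1)⁻¹)) ((1 - (h ^ (-(p - 1)⁻¹)) ^ p) ^ p⁻¹) := by
  have hp1 : 0 < p - 1 := by linarith
  have h0 : 0 < h := by linarith
  have ha0 : 0 < h ^ (-(p - 1)⁻¹) := Real.rpow_pos_of_pos h0 _
  have ha1 : h ^ (-(p - 1)⁻¹) < 1 :=
    Real.rpow_lt_one_of_one_lt_of_neg hh (neg_neg_of_pos (inv_pos.2 hp1))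
  have hb : 0 < 1 - (h ^ (-(p - 1)⁻¹)) ^ p :=
    sub_pos.2 (Real.rpow_lt_one ha0.le ha1 (by linarith))
  refine ⟨hp, ha0, ha1, hh, Real.rpow_pos_of_pos hb _, ?_, ?_⟩
  · rw [Real.rpow_inv_rpow hb.le (by linarith)]
    ring
  · rw [← Real.rpow_mul h0.le, neg_mul, inv_mul_cancel₀ hp1.ne', Real.rpow_neg_one,
      inv_mul_cancel₀ h0.ne']

lemma integral_cone (m : ℕ) {a b h : ℝ} (hha : a < h) :
    ∫ t in a..h, (b / (h - a) * (h - t)) ^ m = b ^ m * (h - a) / (m + 1) := by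
  have hne : h - a ≠ 0 := (sub_pos.2 hha).ne'
  simp_rw [mul_pow]
  rw [intervalIntegral.integral_const_mul,
    intervalIntegral.integral_comp_sub_left (fun s => s ^ m), integral_pow]
  simp only [sub_self, div_pow]
  rw [zero_pow (Nat.succ_ne_zero m), pow_succ]
  field_simp
  ring

lemma integral_rpow_const_mul_one_sub {a c q : ℝ} (ha : a ≤ 1) (hc : 0 ≤ c) (hq : 0 ≤ q) :
    ∫ t in a..1, (c * (1 - t)) ^ q = c ^ q * (1 - a) ^ (q + 1) / (q + 1) := by
  have h : ∫ t in a..1, (c * (1 - t)) ^ q = ∫ t in a..1, c ^ q * (1 - t) ^ q := by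
    refine intervalIntegral.integral_congr fun t ht => ?_
    rw [uIcc_of_le ha] at ht
    exact Real.mul_rpow hc (sub_nonneg.2 ht.2)
  rw [h, intervalIntegral.integral_const_mul,
    intervalIntegral.integral_comp_sub_left (fun s => s ^ q), sub_self,
    integral_rpow (Or.inl (by linarith)), Real.zero_rpow (by linarith)]
  ring

lemma one_sub_rpow_le {p t : ℝ} (hp : 1 ≤ p) (ht : 0 ≤ t) : 1 - t ^ p ≤ p * (1 - t) := by
  have h := one_add_mul_self_le_rpow_one_add (s := t - 1) (by linarith) hp
  rw [add_sub_cancel] at h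
  linarith

lemma le_one_sub_rpow {p a t : ℝ} (hp : 1 ≤ p) (ha : 0 < a) (hat : a ≤ t) (ht : t ≤ 1) :
    p * a ^ (p - 1) * (1 - t) ≤ 1 - t ^ p := by
  have ht0 : 0 < t := ha.trans_le hat
  have h := one_sub_rpow_le hp (inv_nonneg.2 ht0.le)
  have htp : 0 < t ^ p := Real.rpow_pos_of_pos ht0 p
  rw [Real.inv_rpow ht0.le] at h
  have h₁ : t ^ p * (1 - (t ^ p)⁻¹) ≤ t ^ p * (p * (1 - t⁻¹)) := by gcongr
  have h₂ : t ^ p = t ^ (p - 1) * t := by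
    rw [← Real.rpow_add_one ht0.ne']; ring_nf
  have h₃ : t ^ p * (1 - (t ^ p)⁻¹) = t ^ p - 1 := by field_simp
  have h₄ : t ^ p * (p * (1 - t⁻¹)) = p * t ^ (p - 1) * (t - 1) := by
    rw [h₂]; field_simp
  have h₅ : p * a ^ (p - 1) * (1 - t) ≤ p * t ^ (p - 1) * (1 - t) := by gcongr
  linarith

lemma profile_pow {m : ℕ} {p t : ℝ} (ht : 0 ≤ 1 - |t| ^ p) :
    profile p t ^ m = (1 - |t| ^ p) ^ (m / p) := by
  rw [profile, ← Real.rpow_mul_natCast ht]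
  ring_nf

lemma integral_profile_mem_Icc (m : ℕ) {p a : ℝ} (hp : 1 < p) (ha : 0 < a) (ha1 : a ≤ 1) :
    ∫ t in a..1, profile p t ^ m ∈
      Icc ((p * a ^ (p - 1)) ^ (m / p) * (1 - a) ^ (m / p + 1) / (m / p + 1))
        (p ^ (m / p) * (1 - a) ^ (m / p + 1) / (m / p + 1)) := by
  have hp0 : 0 < p := by linarith
  have hq : 0 ≤ m / p := by positivity
  have hI : IntervalIntegrable (fun t => profile p t ^ m) volume a 1 :=
    ((continuous_profile hp0).pow m).intervalIntegrable _ _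
  have hL : ∀ c : ℝ, IntervalIntegrable (fun t => (c * (1 - t)) ^ (m / p)) volume a 1 := fun c =>
    (Continuous.rpow_const (by fun_prop) fun _ => Or.inr hq).intervalIntegrable _ _
  have hc : 0 ≤ p * a ^ (p - 1) := by positivity
  rw [← integral_rpow_const_mul_one_sub ha1 hc hq,
    ← integral_rpow_const_mul_one_sub ha1 hp0.le hq]
  constructor
  · refine intervalIntegral.integral_mono_on ha1 (hL _) hI fun t ht => ?_
    have h0 := one_sub_abs_rpow_nonneg hp0 ha.le ht
    rw [profile_pow h0]
    rw [abs_of_nonneg (ha.le.trans ht.1)] at h0 ⊢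
    exact Real.rpow_le_rpow (mul_nonneg hc (sub_nonneg.2 ht.2))
      (le_one_sub_rpow hp.le ha ht.1 ht.2) hq
  · refine intervalIntegral.integral_mono_on ha1 hI (hL _) fun t ht => ?_
    have h0 := one_sub_abs_rpow_nonneg hp0 ha.le ht
    rw [profile_pow h0]
    rw [abs_of_nonneg (ha.le.trans ht.1)] at h0 ⊢
    exact Real.rpow_le_rpow h0 (one_sub_rpow_le hp.le (ha.le.trans ht.1)) hq

lemma hatVol_one_add {m : ℕ} (hm : 1 ≤ m) {p Δ : ℝ} (hp : 1 < p) (hΔ : 0 < Δ) :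
    hatVol m p (1 + Δ) = lpBallVol m p *
      ((1 - ((1 + Δ) ^ (-(p - 1)⁻¹)) ^ p) ^ (m / p + 1) * (1 + Δ) / (m + 1)
        - ∫ t in ((1 + Δ) ^ (-(p - 1)⁻¹))..1, profile p t ^ m) := by
  have H := tangentData hp (by linarith : 1 < 1 + Δ)
  rw [H.hatVol_eq hm, integral_cone m (H.a_lt.trans H.lt_h)]
  have hw : 0 < 1 - ((1 + Δ) ^ (-(p - 1)⁻¹)) ^ p :=
    sub_pos.2 (Real.rpow_lt_one H.a_pos.le H.a_lt (by linarith))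
  have h₁ := H.b_rpow
  have h₂ := H.tangent
  rw [Real.rpow_inv_rpow hw.le (by linarith)] at h₁
  generalize (1 + Δ) ^ (-(p - 1)⁻¹) = a at *
  have h₃ : 1 + Δ - a = (1 - a ^ p) * (1 + Δ) := by
    rw [h₁]; linear_combination (-(1 + Δ - a)) * h₂
  rw [← Real.rpow_mul_natCast hw.le, h₃, Real.rpow_add_one hw.ne', inv_mul_eq_div, mul_assoc]

lemma tendsto_one_sub_rpow_div (q : ℝ) :
    Tendsto (fun Δ : ℝ => (1 - (1 + Δ) ^ (-q)) / Δ) (𝓝[>] 0) (𝓝 q) := by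
  have h₁ : HasDerivAt (fun Δ : ℝ => (1 + Δ) ^ (-q)) (-q) 0 := by
    have := ((hasDerivAt_id (0 : ℝ)).const_add 1).rpow_const (p := -q) (Or.inl (by simp))
    simpa using this
  have h₂ := (h₁.tendsto_slope.mono_left
    (nhdsWithin_mono (0 : ℝ) fun x (hx : 0 < x) => hx.ne')).neg
  rw [neg_neg] at h₂
  refine h₂.congr fun Δ => ?_
  simp [slope_def_field]
  ring

lemma tendsto_hatVol_div {m : ℕ} (hm : 1 ≤ m) {p : ℝ} (hp : 1 < p) :
    Tendsto (fun Δ : ℝ => hatVol m p (1 + Δ) / Δ ^ ((m + p) / p)) (𝓝[>] 0)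
      (𝓝 ((p - 1) / ((m + 1) * (m + p)) * (p / (p - 1)) ^ ((m + p) / p) * lpBallVol m p)) := by
  have hp0 : 0 < p := by linarith
  have hp1 : 0 < p - 1 := by linarith
  set e : ℝ := m / p + 1 with he
  have he' : (m + p) / p = e := by rw [he]; field_simp
  have he0 : 0 < e := by positivity
  rw [he']
  set a : ℝ → ℝ := fun Δ => (1 + Δ) ^ (-(p - 1)⁻¹) with ha
  have hs : Tendsto (fun Δ => ((1 - a Δ) / Δ) ^ e) (𝓝[>] 0) (𝓝 ((p - 1)⁻¹ ^ e)) :=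
    (tendsto_one_sub_rpow_div (p - 1)⁻¹).rpow_const (Or.inr he0.le)
  have hw : Tendsto (fun Δ => ((1 - a Δ ^ p) / Δ) ^ e) (𝓝[>] 0) (𝓝 ((p / (p - 1)) ^ e)) := by
    refine ((tendsto_one_sub_rpow_div (p / (p - 1))).congr' ?_).rpow_const (Or.inr he0.le)
    filter_upwards [self_mem_nhdsWithin] with Δ hΔ
    have hΔ' : (0 : ℝ) < Δ := hΔ
    rw [ha, ← Real.rpow_mul (by linarith)]
    ring_nf
  have hΔ0 : Tendsto (fun Δ : ℝ => 1 + Δ) (𝓝[>] 0) (𝓝 1) := by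
    have h : Continuous fun Δ : ℝ => 1 + Δ := by fun_prop
    exact (h.tendsto' 0 1 (add_zero 1)).mono_left nhdsWithin_le_nhds
  have ha1 : Tendsto a (𝓝[>] 0) (𝓝 1) := by
    simpa using hΔ0.rpow_const (p := -(p - 1)⁻¹) (Or.inl one_ne_zero)
  have hlow : Tendsto (fun Δ => (p * a Δ ^ (p - 1)) ^ (m / p) * ((1 - a Δ) / Δ) ^ e / e) (𝓝[>] 0)
      (𝓝 (p ^ (m / p) * (p - 1)⁻¹ ^ e / e)) := by
    have h₁ : Tendsto (fun Δ => p * a Δ ^ (p - 1)) (𝓝[>] 0) (𝓝 p) := by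
      simpa using (ha1.rpow_const (p := p - 1) (Or.inl one_ne_zero)).const_mul p
    exact ((h₁.rpow_const (Or.inl hp0.ne')).mul hs).div_const e
  have hup : Tendsto (fun Δ => p ^ (m / p) * ((1 - a Δ) / Δ) ^ e / e) (𝓝[>] 0)
      (𝓝 (p ^ (m / p) * (p - 1)⁻¹ ^ e / e)) := (hs.const_mul _).div_const e
  have hcap : Tendsto (fun Δ => (∫ t in (a Δ)..1, profile p t ^ m) / Δ ^ e) (𝓝[>] 0)
      (𝓝 (p ^ (m / p) * (p - 1)⁻¹ ^ e / e)) := by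
    refine tendsto_of_tendsto_of_tendsto_of_le_of_le' hlow hup ?_ ?_ <;>
    · filter_upwards [self_mem_nhdsWithin] with Δ hΔ
      have hΔ' : (0 : ℝ) < Δ := hΔ
      have H := tangentData hp (by linarith : 1 < 1 + Δ)
      have hI := integral_profile_mem_Icc m hp H.a_pos H.a_lt.le
      have hΔe : 0 < Δ ^ e := Real.rpow_pos_of_pos hΔ' e
      have hdiv : ((1 - a Δ) / Δ) ^ e = (1 - a Δ) ^ e / Δ ^ e :=
        Real.div_rpow (sub_nonneg.2 H.a_lt.le) hΔ'.le e
      rw [hdiv, ← mul_div_assoc, div_right_comm]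
      gcongr
      first | exact hI.1 | exact hI.2
  have hmain := ((((hw.mul hΔ0).div_const ((m : ℝ) + 1)).sub hcap).const_mul (lpBallVol m p))
  have hlim : lpBallVol m p * ((p / (p - 1)) ^ e * 1 / ((m : ℝ) + 1)
      - p ^ (m / p) * (p - 1)⁻¹ ^ e / e)
      = (p - 1) / ((m + 1) * (m + p)) * (p / (p - 1)) ^ e * lpBallVol m p := by
    have h₁ : p ^ (m / p) * (p - 1)⁻¹ ^ e = (p / (p - 1)) ^ e / p := by
      rw [div_eq_mul_inv p (p - 1), Real.mul_rpow hp0.le (inv_nonneg.2 hp1.le), he,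
        Real.rpow_add_one hp0.ne']
      field_simp
    rw [h₁, ← he']
    have : (m : ℝ) + p ≠ 0 := by positivity
    field_simp
    ring
  rw [hlim] at hmain
  refine hmain.congr' ?_
  filter_upwards [self_mem_nhdsWithin] with Δ hΔ
  have hΔ' : (0 : ℝ) < Δ := hΔ
  have H := tangentData hp (by linarith : 1 < 1 + Δ)
  have hw0 : 0 ≤ 1 - a Δ ^ p := sub_nonneg.2 (Real.rpow_le_one H.a_pos.le H.a_lt.le hp0.le)
  rw [hatVol_one_add hm hp hΔ', Real.div_rpow hw0 hΔ'.le]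
  ring

lemma hatVol_one (m : ℕ) {p : ℝ} (hp : 1 < p) : hatVol m p 1 = 0 := by
  have hmem : EuclideanSpace.single 0 1 ∈ lpBall (m + 1) p := by
    simp [lpBall, Fin.sum_univ_succ, Real.zero_rpow (by linarith : p ≠ 0)]
  rw [hatVol, union_eq_left.2 (singleton_subset_iff.2 hmem),
    (convex_lpBall (m + 1) hp.le).convexHull_eq, sdiff_self]
  simp
/-- Lemma 4.6: the volume of the hat `H_p^n(Δ) = conv(B_p^n ∪ {(1+Δ)e₁}) \ B_p^n` equals
`((p−1)/(n(n−1+p)))·|B_p^{n−1}|·((p/(p−1))Δ)^{(n−1+p)/p}·(1 + ψ_p^n(Δ))` with `ψ_p^n(Δ) → 0`. -/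
theorem statement18 {n : ℕ} (hn : 2 ≤ n) (p : ℝ) (hp : 1 < p) :
    ∃ ψ : ℝ → ℝ, Tendsto ψ (𝓝[>] 0) (𝓝 0) ∧
      (∀ Δ : ℝ, 0 ≤ Δ → Δ ≤ 1 →
        (volume (convexHull ℝ (lpBall n p ∪ {EuclideanSpace.single ⟨0, by omega⟩ (1 + Δ)})
            \ lpBall n p)).toReal
          = (p - 1)/((n:ℝ)*((n:ℝ) - 1 + p)) * (volume (lpBall (n-1) p)).toReal *
            (p/(p - 1)*Δ) ^ (((n:ℝ) - 1 + p)/p) * (1 + ψ Δ)) ∧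
      Tendsto (fun Δ : ℝ =>
          (volume (convexHull ℝ (lpBall n p ∪ {EuclideanSpace.single ⟨0, by omega⟩ (1 + Δ)})
              \ lpBall n p)).toReal / Δ ^ (((n:ℝ) - 1 + p)/p)) (𝓝[>] 0)
        (𝓝 ((p - 1)/((n:ℝ)*((n:ℝ) - 1 + p)) * (p/(p - 1)) ^ (((n:ℝ) - 1 + p)/p)
          * (volume (lpBall (n-1) p)).toReal)) := by
  obtain ⟨m, rfl⟩ : ∃ m, n = m + 1 := ⟨n - 1, by omega⟩
  have hm : 1 ≤ m := by omega
  have hp0 : 0 < p := by linarith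
  have hp1 : 0 < p - 1 := by linarith
  change ∃ ψ : ℝ → ℝ, Tendsto ψ (𝓝[>] 0) (𝓝 0) ∧
    (∀ Δ : ℝ, 0 ≤ Δ → Δ ≤ 1 → hatVol m p (1 + Δ)
      = (p - 1) / (((m + 1 : ℕ) : ℝ) * (((m + 1 : ℕ) : ℝ) - 1 + p)) *
        (volume (lpBall m p)).toReal *
        (p / (p - 1) * Δ) ^ ((((m + 1 : ℕ) : ℝ) - 1 + p) / p) * (1 + ψ Δ)) ∧
    Tendsto (fun Δ : ℝ => hatVol m p (1 + Δ) / Δ ^ ((((m + 1 : ℕ) : ℝ) - 1 + p) / p)) (𝓝[>] 0)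
      (𝓝 ((p - 1) / (((m + 1 : ℕ) : ℝ) * (((m + 1 : ℕ) : ℝ) - 1 + p)) *
        (p / (p - 1)) ^ ((((m + 1 : ℕ) : ℝ) - 1 + p) / p) * (volume (lpBall m p)).toReal))
  rw [volume_lpBall hm hp]
  push_cast
  rw [add_sub_cancel_right]
  have hlim := tendsto_hatVol_div hm hp
  have hκ := lpBallVol_pos m hp0
  have he : 0 < (m + p) / p := by positivity
  generalize (m + p) / p = e at *
  set c := (p - 1) / (((m : ℝ) + 1) * (m + p)) * (p / (p - 1)) ^ e * lpBallVol m p with hc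
  have hc0 : 0 < c := by positivity
  refine ⟨fun Δ => hatVol m p (1 + Δ) / Δ ^ e / c - 1, ?_, fun Δ hΔ _ => ?_, hlim⟩
  · simpa [hc0.ne'] using (hlim.div_const c).sub_const 1
  · rcases hΔ.eq_or_lt with rfl | hpos
    · rw [add_zero, hatVol_one m hp, mul_zero, Real.zero_rpow he.ne', mul_zero, zero_mul]
    · have hΔe : 0 < Δ ^ e := Real.rpow_pos_of_pos hpos e
      have hcΔ : (p - 1) / (((m : ℝ) + 1) * (m + p)) * lpBallVol m p * (p / (p - 1) * Δ) ^ e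
          = c * Δ ^ e := by
        rw [Real.mul_rpow (by positivity) hΔ, hc]
        ring
      rw [hcΔ]
      field_simp
      ring
end
end
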